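/- If ρ is a state on C² ⊗ C² diagonal in a maximally entangled basis, i.e. ρ = Σ_i λ_i P_i where (P_i) is a von Neumann measurement in a maximally entangled basis of C² ⊗ C² and (λ_i) is a probability distribution, then the entropic entanglement parameter satisfies M(ρ) = 1 − S(ρ). In particular, for the maximally entangled state ψ₊² = (1/√2)(|00⟩ + |11⟩), M(|ψ₊²⟩⟨ψ₊²|) = 1. -/

import Mathlib

open Matrix Kronecker BigOperators ComplexOrder

noncomputable section

namespace EEP

/-- `-(x * log₂ x)`; note `Real.logb 2 0 = 0`, giving the convention `0·log₂ 0 = 0`. -/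
def negMulLog2 (x : ℝ) : ℝ := -(x * Real.logb 2 x)

/-- Shannon entropy (base 2) of a finite family of reals. -/
def shannon {n : Type*} [Fintype n] (p : n → ℝ) : ℝ := ∑ i, negMulLog2 (p i)

/-- A quantum state: positive semidefinite (hence Hermitian) matrix with trace 1. -/
def IsState {n : Type*} [Fintype n] [DecidableEq n] (ρ : Matrix n n ℂ) : Prop :=
  ρ.PosSemidef ∧ ρ.trace = 1

/-- A rank-one orthogonal projection matrix. -/
def IsRankOneProj {n : Type*} [Fintype n] [DecidableEq n] (P : Matrix n n ℂ) : Prop :=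
  P.IsHermitian ∧ P * P = P ∧ P.rank = 1

/-- A von Neumann measurement on `C^d ⊗ C^d`: a family of `d²` rank-one orthogonal
projections, mutually orthogonal, summing to the identity. -/
def IsMeasurement {d : ℕ} (P : Fin (d^2) → Matrix (Fin d × Fin d) (Fin d × Fin d) ℂ) : Prop :=
  (∀ i, IsRankOneProj (P i)) ∧ (∀ i j, i ≠ j → P i * P j = 0) ∧ (∑ i, P i) = 1

/-- Klein entropy: Shannon entropy of the outcome distribution `pᵢ = Tr(ρ Pᵢ)`. -/
def kleinEntropy {d : ℕ} (ρ : Matrix (Fin d × Fin d) (Fin d × Fin d) ℂ)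
    (P : Fin (d^2) → Matrix (Fin d × Fin d) (Fin d × Fin d) ℂ) : ℝ :=
  shannon (fun i => (ρ * P i).trace.re)

/-- A product state: Kronecker product of two states on `C^d`. -/
def IsProductState {d : ℕ} (δ : Matrix (Fin d × Fin d) (Fin d × Fin d) ℂ) : Prop :=
  ∃ σA σB : Matrix (Fin d) (Fin d) ℂ, IsState σA ∧ IsState σB ∧ δ = σA ⊗ₖ σB

/-- Infimum of the Klein entropy over product states, for a fixed measurement. -/
def infProd {d : ℕ} (P : Fin (d^2) → Matrix (Fin d × Fin d) (Fin d × Fin d) ℂ) : ℝ :=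
  sInf {x : ℝ | ∃ δ, IsProductState δ ∧ x = kleinEntropy δ P}

/-- The entropic entanglement parameter
`M(ρ) = sup_P ( inf_{δ product} H(δ,P) − H(ρ,P) )`. -/
def eep {d : ℕ} (ρ : Matrix (Fin d × Fin d) (Fin d × Fin d) ℂ) : ℝ :=
  sSup {x : ℝ | ∃ P, IsMeasurement P ∧ x = infProd P - kleinEntropy ρ P}

/-- A separable state: finite convex combination of product states. -/
def IsSeparable {d : ℕ} (ρ : Matrix (Fin d × Fin d) (Fin d × Fin d) ℂ) : Prop :=
  ∃ (m : ℕ) (p : Fin m → ℝ) (δ : Fin m → Matrix (Fin d × Fin d) (Fin d × Fin d) ℂ),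
    (∀ i, 0 ≤ p i) ∧ (∑ i, p i) = 1 ∧ (∀ i, IsProductState (δ i)) ∧
    ρ = ∑ i, (p i : ℂ) • δ i

/-- Rank-one projection `|v⟩⟨v|` onto a vector `v`. -/
def projVec {n : Type*} (v : n → ℂ) : Matrix n n ℂ := Matrix.vecMulVec v (star v)

/-- Coefficient matrix `A` of a vector `ψ ∈ C^d ⊗ C^d`, `A i j = ψ (i,j)`. -/
def coeffMat {d : ℕ} (ψ : Fin d × Fin d → ℂ) : Matrix (Fin d) (Fin d) ℂ :=
  Matrix.of fun i j => ψ (i, j)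

/-- The squared Schmidt coefficients of `ψ`: the eigenvalues of `A Aᴴ`
where `A` is the coefficient matrix of `ψ`. -/
def schmidtSq {d : ℕ} (ψ : Fin d × Fin d → ℂ) : Fin d → ℝ :=
  (Matrix.isHermitian_mul_conjTranspose_self (coeffMat ψ)).eigenvalues

/-- Largest squared Schmidt coefficient (square of the largest singular value of `A`). -/
def maxSchmidtSq {d : ℕ} (ψ : Fin d × Fin d → ℂ) : ℝ := ⨆ i, schmidtSq ψ i

/-- A unit vector. -/
def IsUnitVec {n : Type*} [Fintype n] (ψ : n → ℂ) : Prop := (∑ p, Complex.normSq (ψ p)) = 1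

/-- A maximally entangled unit vector: all squared Schmidt coefficients equal `1/d`. -/
def IsMaxEntVec {d : ℕ} (ψ : Fin d × Fin d → ℂ) : Prop :=
  IsUnitVec ψ ∧ ∀ i, schmidtSq ψ i = 1 / d

/-- A von Neumann measurement in a maximally entangled basis. -/
def IsMaxEntMeasurement {d : ℕ}
    (P : Fin (d^2) → Matrix (Fin d × Fin d) (Fin d × Fin d) ℂ) : Prop :=
  IsMeasurement P ∧ ∀ i, ∃ ψ, IsMaxEntVec ψ ∧ P i = projVec ψ

/-- Von Neumann entropy: Shannon entropy of the eigenvalues. -/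
def vnEntropy {n : Type*} [Fintype n] [DecidableEq n] {ρ : Matrix n n ℂ}
    (h : ρ.IsHermitian) : ℝ := shannon h.eigenvalues

/-- Binary Shannon entropy. -/
def binEnt (x : ℝ) : ℝ := negMulLog2 x + negMulLog2 (1 - x)

/-- A family of mutually orthogonal projections of trace one which sums to the identity. -/
structure Fam {ι n : Type*} [Fintype ι] [Fintype n] [DecidableEq n]
    (P : ι → Matrix n n ℂ) : Prop where
  herm : ∀ i, (P i).IsHermitian
  idem : ∀ i, P i * P i = P i
  orth : ∀ i j, i ≠ j → P i * P j = 0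
  tr : ∀ i, (P i).trace = 1
  sum : ∑ i, P i = 1

lemma negMulLog2_eq (x : ℝ) : negMulLog2 x = Real.negMulLog x / Real.log 2 := by
  unfold negMulLog2 Real.negMulLog Real.logb
  ring

lemma negMulLog2_zero : negMulLog2 0 = 0 := by simp [negMulLog2]

lemma negMulLog2_one : negMulLog2 1 = 0 := by simp [negMulLog2]

lemma jensen {ι κ : Type*} [Fintype ι] [Fintype κ] (w : ι → κ → ℝ) (l : ι → ℝ)
    (hw : ∀ i k, 0 ≤ w i k) (h1 : ∀ i, ∑ k, w i k = 1) (h2 : ∀ k, ∑ i, w i k = 1)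
    (hl : ∀ i, 0 ≤ l i) :
    shannon l ≤ shannon (fun k => ∑ i, l i * w i k) := by
  unfold shannon
  have hlog : 0 < Real.log 2 := Real.log_pos (by norm_num)
  simp only [negMulLog2_eq, ← Finset.sum_div]
  apply div_le_div_of_nonneg_right _ hlog.le
  have key : ∀ k, ∑ i, w i k * Real.negMulLog (l i) ≤ Real.negMulLog (∑ i, l i * w i k) := by
    intro k
    have := Real.concaveOn_negMulLog.le_map_sum (t := Finset.univ) (w := fun i => w i k) (p := l)
      (fun i _ => hw i k) (h2 k) (fun i _ => hl i)
    simpa [smul_eq_mul, mul_comm] using this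
  calc ∑ i, Real.negMulLog (l i) = ∑ i, ∑ k, w i k * Real.negMulLog (l i) := by
        simp only [← Finset.sum_mul, h1, one_mul]
    _ = ∑ k, ∑ i, w i k * Real.negMulLog (l i) := Finset.sum_comm
    _ ≤ _ := Finset.sum_le_sum fun k _ => key k

lemma trace_mul_proj_nonneg {n : Type*} [Fintype n] [DecidableEq n] {ρ Q : Matrix n n ℂ}
    (hρ : ρ.PosSemidef) (h1 : Q.IsHermitian) (h2 : Q * Q = Q) : 0 ≤ (ρ * Q).trace.re := by
  have h : (ρ * Q).trace = (Qᴴ * ρ * Q).trace := by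
    rw [h1.eq, Matrix.trace_mul_cycle, h2, Matrix.trace_mul_comm]
  rw [h]
  exact (Complex.le_def.1 (hρ.conjTranspose_mul_mul_same Q).trace_nonneg).1

lemma Fam.psd {ι n : Type*} [Fintype ι] [Fintype n] [DecidableEq n]
    {P : ι → Matrix n n ℂ} (h : Fam P) (i : ι) : (P i).PosSemidef := by
  have := Matrix.posSemidef_conjTranspose_mul_self (P i)
  rwa [(h.herm i).eq, h.idem i] at this

lemma Fam.shannon_le {ι κ n : Type*} [Fintype ι] [Fintype κ] [Fintype n] [DecidableEq n]
    {P : ι → Matrix n n ℂ} {Q : κ → Matrix n n ℂ} (hP : Fam P) (hQ : Fam Q)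
    (l : ι → ℝ) (hl : ∀ i, 0 ≤ l i) (ρ : Matrix n n ℂ) (hρ : ρ = ∑ i, (l i : ℂ) • P i) :
    shannon l ≤ shannon (fun k => (ρ * Q k).trace.re) := by
  have := jensen (fun i k => (P i * Q k).trace.re) l
    (fun i k => trace_mul_proj_nonneg (hP.psd i) (hQ.herm k) (hQ.idem k))
    (fun i => by
      rw [← Complex.re_sum, ← Matrix.trace_sum, ← Finset.mul_sum, hQ.sum, mul_one, hP.tr]; rfl)
    (fun k => by
      rw [← Complex.re_sum, ← Matrix.trace_sum, ← Finset.sum_mul, hP.sum, one_mul, hQ.tr]; rfl)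
    hl
  convert this using 3 with k
  rw [hρ, Finset.sum_mul, Matrix.trace_sum, Complex.re_sum]
  simp [Matrix.smul_mul, Matrix.trace_smul]

lemma Fam.probs {ι n : Type*} [Fintype ι] [Fintype n] [DecidableEq n]
    {P : ι → Matrix n n ℂ} (hP : Fam P)
    (l : ι → ℝ) (ρ : Matrix n n ℂ) (hρ : ρ = ∑ i, (l i : ℂ) • P i) :
    (fun k => (ρ * P k).trace.re) = l := by
  funext k
  rw [hρ, Finset.sum_mul, Finset.sum_eq_single k]
  · simp [Matrix.smul_mul, Matrix.trace_smul, hP.idem, hP.tr]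
  · intro b _ hb
    rw [Matrix.smul_mul, hP.orth b k hb, smul_zero]
  · simp

lemma spectral_fam {n : Type*} [Fintype n] [DecidableEq n] {ρ : Matrix n n ℂ}
    (h : ρ.IsHermitian) : ∃ Q : n → Matrix n n ℂ, Fam Q ∧
      ρ = ∑ i, (h.eigenvalues i : ℂ) • Q i := by
  set U : Matrix n n ℂ := (h.eigenvectorUnitary : Matrix n n ℂ) with hU
  have hUU : star U * U = 1 := Unitary.coe_star_mul_self _
  have hUU' : U * star U = 1 := Unitary.coe_mul_star_self _
  have hm : ∀ A B : Matrix n n ℂ, U * A * star U * (U * B * star U) = U * (A * B) * star U := by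
    intro A B
    calc _ = U * A * (star U * U) * B * star U := by simp only [Matrix.mul_assoc]
      _ = _ := by rw [hUU]; simp only [Matrix.mul_assoc, Matrix.one_mul]
  have hs : ∑ i, Matrix.single i i (1 : ℂ) = (1 : Matrix n n ℂ) := by
    ext a b
    simp [Matrix.sum_apply, Matrix.single_apply, Matrix.one_apply, Finset.sum_ite, ite_and]
  refine ⟨fun i => U * Matrix.single i i 1 * star U, ⟨?_, ?_, ?_, ?_, ?_⟩, ?_⟩
  · intro i
    rw [Matrix.IsHermitian, Matrix.star_eq_conjTranspose]
    simp [Matrix.conjTranspose_mul, Matrix.mul_assoc]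
  · intro i
    rw [hm]; simp
  · intro i j hij
    rw [hm, Matrix.single_mul_single_of_ne (h := hij)]; simp
  · intro i
    rw [Matrix.trace_mul_cycle, hUU]; simp
  · rw [← Finset.sum_mul, ← Finset.mul_sum, hs, mul_one, hUU']
  · conv_lhs => rw [h.spectral_theorem, Unitary.conjStarAlgAut_apply]
    have : Matrix.diagonal (RCLike.ofReal ∘ h.eigenvalues) =
        ∑ i, (h.eigenvalues i : ℂ) • Matrix.single i i (1 : ℂ) := by
      ext a b
      simp [Matrix.sum_apply, Matrix.single_apply, Matrix.diagonal_apply, ite_and]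
    rw [this, Finset.mul_sum, Finset.sum_mul]
    apply Finset.sum_congr rfl
    intro i _
    rw [Matrix.mul_smul, Matrix.smul_mul]

lemma vnEntropy_eq {ι n : Type*} [Fintype ι] [Fintype n] [DecidableEq n] {ρ : Matrix n n ℂ}
    (h : ρ.PosSemidef) {P : ι → Matrix n n ℂ} (hP : Fam P) (l : ι → ℝ) (hl : ∀ i, 0 ≤ l i)
    (hρ : ρ = ∑ i, (l i : ℂ) • P i) : vnEntropy h.1 = shannon l := by
  obtain ⟨Q, hQ, hρQ⟩ := spectral_fam h.1
  apply le_antisymm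
  · have := hQ.shannon_le hP _ h.eigenvalues_nonneg ρ hρQ
    rwa [hP.probs l ρ hρ] at this
  · have := hP.shannon_le hQ _ hl ρ hρ
    rwa [hQ.probs _ ρ hρQ] at this

lemma rank_one_form {n : Type*} [Fintype n] [DecidableEq n] {P : Matrix n n ℂ}
    (h : P.rank = 1) : ∃ u w : n → ℂ, P = vecMulVec u w := by
  rw [Matrix.rank] at h
  obtain ⟨v, -, hv⟩ := finrank_eq_one_iff'.1 h
  choose c hc using hv
  refine ⟨v.1, fun j => c ⟨P *ᵥ Pi.single j 1, ⟨_, rfl⟩⟩, ?_⟩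
  ext i j
  have := congrFun (congrArg Subtype.val (hc ⟨P *ᵥ Pi.single j 1, ⟨_, rfl⟩⟩)) i
  have e : (P *ᵥ Pi.single j 1) i = P i j := by simp
  exact e.symm.trans (this.symm.trans (mul_comm _ _))

lemma IsRankOneProj.tr {n : Type*} [Fintype n] [DecidableEq n] {P : Matrix n n ℂ}
    (h : IsRankOneProj P) : P.trace = 1 := by
  obtain ⟨u, w, hP⟩ := rank_one_form h.2.2
  have h0 : P ≠ 0 := by
    rintro h0
    have := h.2.2
    simp [h0] at this
  have h2 := h.2.1
  have : P * P = P.trace • P := by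
    rw [hP, Matrix.vecMulVec_mul_vecMulVec, Matrix.trace_vecMulVec, dotProduct_comm u w]
    ext i j
    simp [Matrix.vecMulVec_apply]; ring
  rw [this] at h2
  have h3 : (P.trace - 1) • P = 0 := by rw [sub_smul, h2]; simp
  rcases smul_eq_zero.1 h3 with h | h
  · linear_combination h
  · exact absurd h h0

lemma IsMeasurement.fam {d : ℕ} {P : Fin (d^2) → Matrix (Fin d × Fin d) (Fin d × Fin d) ℂ}
    (h : IsMeasurement P) : Fam P :=
  ⟨fun i => (h.1 i).1, fun i => (h.1 i).2.1, h.2.1, fun i => (h.1 i).tr, h.2.2⟩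

lemma IsProductState.psd {d : ℕ} {δ : Matrix (Fin d × Fin d) (Fin d × Fin d) ℂ}
    (h : IsProductState δ) : δ.PosSemidef := by
  obtain ⟨a, b, ha, hb, rfl⟩ := h
  exact ha.1.kronecker hb.1

lemma IsProductState.tr {d : ℕ} {δ : Matrix (Fin d × Fin d) (Fin d × Fin d) ℂ}
    (h : IsProductState δ) : δ.trace = 1 := by
  obtain ⟨a, b, ha, hb, rfl⟩ := h
  rw [Matrix.trace_kronecker, ha.2, hb.2, one_mul]

lemma Fam.prob_nonneg {ι n : Type*} [Fintype ι] [Fintype n] [DecidableEq n]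
    {P : ι → Matrix n n ℂ} (hP : Fam P) {ρ : Matrix n n ℂ} (h : ρ.PosSemidef) (i : ι) :
    0 ≤ (ρ * P i).trace.re := trace_mul_proj_nonneg h (hP.herm i) (hP.idem i)

lemma Fam.prob_sum {ι n : Type*} [Fintype ι] [Fintype n] [DecidableEq n]
    {P : ι → Matrix n n ℂ} (hP : Fam P) {ρ : Matrix n n ℂ} (h : ρ.trace = 1) :
    ∑ i, (ρ * P i).trace.re = 1 := by
  rw [← Complex.re_sum, ← Matrix.trace_sum, ← Finset.mul_sum, hP.sum, mul_one, h]; rfl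

lemma shannon_nonneg {ι : Type*} [Fintype ι] (p : ι → ℝ) (h0 : ∀ i, 0 ≤ p i)
    (h1 : ∑ i, p i = 1) : 0 ≤ shannon p := by
  apply Finset.sum_nonneg
  intro i _
  rw [negMulLog2_eq]
  have : p i ≤ 1 := h1 ▸ Finset.single_le_sum (fun j _ => h0 j) (Finset.mem_univ i)
  exact div_nonneg (Real.negMulLog_nonneg (h0 i) this) (Real.log_pos (by norm_num)).le

lemma one_le_shannon {ι : Type*} [Fintype ι] (p : ι → ℝ) (h0 : ∀ i, 0 ≤ p i)
    (h1 : ∑ i, p i = 1) (h2 : ∀ i, p i ≤ 1 / 2) : 1 ≤ shannon p := by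
  rw [← h1]
  apply Finset.sum_le_sum
  intro i _
  unfold negMulLog2
  rcases (h0 i).eq_or_lt with h | h
  · simp [← h]
  · have : Real.logb 2 (p i) ≤ -1 := by
      have := Real.logb_le_logb_of_le (b := 2) (by norm_num) h (h2 i)
      have h3 : Real.logb 2 (1 / 2) = -1 := by
        rw [one_div, Real.logb_inv, Real.logb_self_eq_one (by norm_num)]
      linarith
    nlinarith

lemma binary_le_one (x y : ℝ) (h : x + y = 1) : negMulLog2 x + negMulLog2 y ≤ 1 := by
  obtain rfl : y = 1 - x := by linarith
  rw [negMulLog2_eq, negMulLog2_eq, ← add_div, ← Real.binEntropy_eq_negMulLog_add_negMulLog_one_sub,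
    div_le_one (Real.log_pos (by norm_num))]
  exact Real.binEntropy_le_log_two

/-- A complex binary quadratic form has a nontrivial zero. -/
lemma exists_root (α β γ : ℂ) : ∃ x y : ℂ, (x ≠ 0 ∨ y ≠ 0) ∧
    α * x ^ 2 + β * (x * y) + γ * y ^ 2 = 0 := by
  by_cases hα : α = 0
  · exact ⟨1, 0, by simp, by simp [hα]⟩
  · obtain ⟨s, hs⟩ := IsAlgClosed.exists_pow_nat_eq (discrim α β γ) (n := 2) (by norm_num)
    obtain ⟨x, hx⟩ := exists_quadratic_eq_zero hα ⟨s, by rw [← hs]; ring⟩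
    exact ⟨x, 1, by simp, by linear_combination hx⟩

lemma exists_product_vec (w z : Fin 2 × Fin 2 → ℂ) : ∃ a b : Fin 2 → ℂ, a ≠ 0 ∧ b ≠ 0 ∧
    (w ⬝ᵥ fun p => a p.1 * b p.2) = 0 ∧ (z ⬝ᵥ fun p => a p.1 * b p.2) = 0 := by
  obtain ⟨x, y, hxy, h⟩ := exists_root
    (w (0,0) * z (0,1) - w (0,1) * z (0,0))
    (w (0,0) * z (1,1) + w (1,0) * z (0,1) - w (0,1) * z (1,0) - w (1,1) * z (0,0))
    (w (1,0) * z (1,1) - w (1,1) * z (1,0))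
  have hdet : (!![x * w (0,0) + y * w (1,0), x * w (0,1) + y * w (1,1);
      x * z (0,0) + y * z (1,0), x * z (0,1) + y * z (1,1)] : Matrix (Fin 2) (Fin 2) ℂ).det = 0 := by
    rw [Matrix.det_fin_two_of]
    linear_combination h
  obtain ⟨b, hb, hb2⟩ := Matrix.exists_mulVec_eq_zero_iff.2 hdet
  have e0 := congrFun hb2 0
  have e1 := congrFun hb2 1
  simp [Matrix.mulVec, dotProduct, Fin.sum_univ_two] at e0 e1
  refine ⟨![x, y], b, ?_, hb, ?_, ?_⟩
  · intro h0
    have h1 := congrFun h0 0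
    have h2 := congrFun h0 1
    simp at h1 h2
    simp [h1, h2] at hxy
  · simp [dotProduct, Fintype.sum_prod_type, Fin.sum_univ_two]
    linear_combination e0
  · simp [dotProduct, Fintype.sum_prod_type, Fin.sum_univ_two]
    linear_combination e1

lemma exists_pure_state (a : Fin 2 → ℂ) (ha : a ≠ 0) :
    ∃ c : ℂ, IsState (c • vecMulVec a (star a)) := by
  have hp := Matrix.posSemidef_vecMulVec_self_star a
  have h0 : (vecMulVec a (star a)).trace ≠ 0 := by
    rw [Matrix.trace_vecMulVec]
    exact fun h => ha (dotProduct_star_self_eq_zero.1 ((dotProduct_comm _ _).trans h))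
  have h1 := hp.trace_nonneg
  refine ⟨(vecMulVec a (star a)).trace⁻¹, hp.smul (inv_nonneg.2 h1), ?_⟩
  rw [Matrix.trace_smul, smul_eq_mul, inv_mul_cancel₀ h0]

lemma exists_low_entropy {P : Fin (2^2) → Matrix (Fin 2 × Fin 2) (Fin 2 × Fin 2) ℂ}
    (h : IsMeasurement P) : ∃ δ, IsProductState δ ∧ kleinEntropy δ P ≤ 1 := by
  obtain ⟨u2, w2, h2⟩ := rank_one_form (h.1 2).2.2
  obtain ⟨u3, w3, h3⟩ := rank_one_form (h.1 3).2.2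
  obtain ⟨a, b, ha, hb, e2, e3⟩ := exists_product_vec w2 w3
  obtain ⟨c, hc⟩ := exists_pure_state a ha
  obtain ⟨e, he⟩ := exists_pure_state b hb
  have hδ : IsProductState ((c • vecMulVec a (star a)) ⊗ₖ (e • vecMulVec b (star b))) :=
    ⟨_, _, hc, he, rfl⟩
  refine ⟨_, hδ, ?_⟩
  set δ := (c • vecMulVec a (star a)) ⊗ₖ (e • vecMulVec b (star b)) with hδd
  have form : δ = (c * e) • vecMulVec (fun p : Fin 2 × Fin 2 => a p.1 * b p.2)
      (star fun p : Fin 2 × Fin 2 => a p.1 * b p.2) := by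
    ext p q
    simp [hδd, Matrix.kroneckerMap_apply, Matrix.vecMulVec_apply]
    ring
  have zero : ∀ u w : Fin 2 × Fin 2 → ℂ, (w ⬝ᵥ fun p => a p.1 * b p.2) = 0 →
      (δ * vecMulVec u w).trace = 0 := by
    intro u w hw
    rw [Matrix.trace_mul_comm, form, Matrix.mul_smul, Matrix.vecMulVec_mul_vecMulVec, hw]
    simp
  have hs := h.fam.prob_sum hδ.tr
  have t2 : (δ * P 2).trace = 0 := by rw [h2]; exact zero _ _ e2
  have t3 : (δ * P 3).trace = 0 := by rw [h3]; exact zero _ _ e3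
  unfold kleinEntropy shannon
  change ∑ i : Fin 4, _ = _ at hs
  change ∑ i : Fin 4, _ ≤ _
  rw [Fin.sum_univ_four] at hs ⊢
  beta_reduce at hs ⊢
  rw [t2, t3] at hs ⊢
  simp only [Complex.zero_re, add_zero, negMulLog2_zero] at hs ⊢
  exact binary_le_one _ _ hs

lemma trace_mul_le {X Y : Matrix (Fin 2) (Fin 2) ℂ} (hX : X.PosSemidef) (hY : Y.PosSemidef) :
    (X * Y).trace.re ≤ X.trace.re * Y.trace.re := by
  have key : ∀ {Z : Matrix (Fin 2) (Fin 2) ℂ}, Z.PosSemidef → 0 ≤ (Z 0 0).re ∧ 0 ≤ (Z 1 1).re ∧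
      (Z 0 0).im = 0 ∧ (Z 1 1).im = 0 ∧ (Z 1 0).re = (Z 0 1).re ∧ (Z 1 0).im = -(Z 0 1).im ∧
      (Z 0 1).re ^ 2 + (Z 0 1).im ^ 2 ≤ (Z 0 0).re * (Z 1 1).re := by
    intro Z hZ
    have a := Complex.le_def.1 (hZ.diag_nonneg (i := 0))
    have b := Complex.le_def.1 (hZ.diag_nonneg (i := 1))
    have c := hZ.1.apply 1 0
    have d := Complex.le_def.1 hZ.det_nonneg
    rw [Matrix.det_fin_two, ← c] at d
    rw [← c]
    simp at a b d ⊢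
    refine ⟨a.1, b.1, a.2.symm, b.2.symm, ?_⟩
    have := d.1
    rw [← a.2, ← b.2] at this
    nlinarith
  obtain ⟨x1, x2, x3, x4, x5, x6, x7⟩ := key hX
  obtain ⟨y1, y2, y3, y4, y5, y6, y7⟩ := key hY
  simp only [Matrix.trace_fin_two, Matrix.mul_apply, Fin.sum_univ_two, Complex.add_re,
    Complex.mul_re, x3, x4, x5, x6, y3, y4, y5, y6]
  generalize (X 0 0).re = p at *
  generalize (X 1 1).re = q at *
  generalize (Y 0 0).re = r at *
  generalize (Y 1 1).re = s at *
  generalize (X 0 1).re = xr at *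
  generalize (X 0 1).im = xi at *
  generalize (Y 0 1).re = yr at *
  generalize (Y 0 1).im = yi at *
  have h1 : (2 * (xr * yr + xi * yi)) ^ 2 ≤ (p * s + q * r) ^ 2 := by
    have : (xr * yr + xi * yi) ^ 2 ≤ (xr ^ 2 + xi ^ 2) * (yr ^ 2 + yi ^ 2) := by
      nlinarith [sq_nonneg (xr * yi - xi * yr)]
    have h2 : (xr ^ 2 + xi ^ 2) * (yr ^ 2 + yi ^ 2) ≤ (p * q) * (r * s) :=
      mul_le_mul x7 y7 (by positivity) (by positivity)
    nlinarith [sq_nonneg (p * s - q * r)]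
  have h3 := abs_le_of_sq_le_sq h1 (by positivity)
  have := (abs_le.1 h3).2
  nlinarith

lemma overlap_le {δ : Matrix (Fin 2 × Fin 2) (Fin 2 × Fin 2) ℂ} (hδ : IsProductState δ)
    (ψ : Fin 2 × Fin 2 → ℂ) (hψ : coeffMat ψ * (coeffMat ψ)ᴴ = (1 / 2 : ℂ) • 1) :
    (δ * projVec ψ).trace.re ≤ 1 / 2 := by
  obtain ⟨a, b, ha, hb, rfl⟩ := hδ
  have e : ((a ⊗ₖ b) * projVec ψ).trace =
      (((coeffMat ψ)ᴴ * a * coeffMat ψ) * bᵀ).trace := by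
    simp [Matrix.trace, Matrix.mul_apply, projVec, coeffMat, Fintype.sum_prod_type,
      Fin.sum_univ_two, Matrix.vecMulVec_apply, Matrix.kroneckerMap_apply]
    ring
  rw [e]
  have h := trace_mul_le (ha.1.conjTranspose_mul_mul_same (coeffMat ψ)) hb.1.transpose
  have t : ((coeffMat ψ)ᴴ * a * coeffMat ψ).trace = 1 / 2 := by
    rw [Matrix.trace_mul_cycle, hψ, Matrix.smul_mul, Matrix.one_mul, Matrix.trace_smul, ha.2]
    simp
  rw [t, Matrix.trace_transpose, hb.2] at h
  simpa using h

lemma maxEnt_coeff {ψ : Fin 2 × Fin 2 → ℂ} (h : IsMaxEntVec ψ) :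
    coeffMat ψ * (coeffMat ψ)ᴴ = (1 / 2 : ℂ) • 1 := by
  obtain ⟨Q, hQ, e⟩ := spectral_fam (Matrix.isHermitian_mul_conjTranspose_self (coeffMat ψ))
  rw [e]
  have h2 : ∀ i, (Matrix.isHermitian_mul_conjTranspose_self (coeffMat ψ)).eigenvalues i = 1 / 2 := by
    intro i
    have := h.2 i
    unfold schmidtSq at this
    rw [this]; norm_num
  simp only [h2]
  rw [← Finset.smul_sum, hQ.sum]
  norm_num

lemma infProd_le_one {P : Fin (2^2) → Matrix (Fin 2 × Fin 2) (Fin 2 × Fin 2) ℂ}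
    (h : IsMeasurement P) : infProd P ≤ 1 := by
  obtain ⟨δ, hδ, h1⟩ := exists_low_entropy h
  refine le_trans (csInf_le ⟨0, ?_⟩ ⟨δ, hδ, rfl⟩) h1
  rintro x ⟨δ, hδ, rfl⟩
  exact shannon_nonneg _ (fun i => h.fam.prob_nonneg hδ.psd i) (h.fam.prob_sum hδ.tr)

lemma one_le_infProd {P : Fin (2^2) → Matrix (Fin 2 × Fin 2) (Fin 2 × Fin 2) ℂ}
    (h : IsMeasurement P)
    (hm : ∀ i, ∃ ψ, coeffMat ψ * (coeffMat ψ)ᴴ = (1 / 2 : ℂ) • 1 ∧ P i = projVec ψ) :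
    1 ≤ infProd P := by
  obtain ⟨δ, hδ, h1⟩ := exists_low_entropy h
  refine le_csInf ⟨_, δ, hδ, rfl⟩ ?_
  rintro x ⟨δ, hδ, rfl⟩
  refine one_le_shannon _ (fun i => h.fam.prob_nonneg hδ.psd i) (h.fam.prob_sum hδ.tr) ?_
  intro i
  obtain ⟨ψ, hψ, e⟩ := hm i
  rw [e]
  exact overlap_le hδ ψ hψ

lemma eep_eq {P : Fin (2^2) → Matrix (Fin 2 × Fin 2) (Fin 2 × Fin 2) ℂ}
    (h : IsMeasurement P)
    (hm : ∀ i, ∃ ψ, coeffMat ψ * (coeffMat ψ)ᴴ = (1 / 2 : ℂ) • 1 ∧ P i = projVec ψ)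
    (l : Fin (2^2) → ℝ) (hl : ∀ i, 0 ≤ l i) (ρ : Matrix (Fin 2 × Fin 2) (Fin 2 × Fin 2) ℂ)
    (hρ : ρ = ∑ i, (l i : ℂ) • P i) : eep ρ = 1 - shannon l := by
  apply IsGreatest.csSup_eq
  constructor
  · refine ⟨P, h, ?_⟩
    rw [le_antisymm (infProd_le_one h) (one_le_infProd h hm), kleinEntropy, h.fam.probs l ρ hρ]
  · rintro x ⟨Q, hQ, rfl⟩
    have h1 := infProd_le_one hQ
    have h2 : shannon l ≤ kleinEntropy ρ Q := h.fam.shannon_le hQ.fam l hl ρ hρ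
    linarith

/-- The vectors `s(|00⟩+|11⟩), s(|00⟩-|11⟩), s(|01⟩+|10⟩), s(|01⟩-|10⟩)`. -/
def bell (s : ℂ) (i : Fin (2^2)) (p : Fin 2 × Fin 2) : ℂ :=
  (![![![s, 0], ![0, s]], ![![s, 0], ![0, -s]], ![![0, s], ![s, 0]], ![![0, s], ![-s, 0]]] :
    Fin 4 → Fin 2 → Fin 2 → ℂ) i p.1 p.2

lemma bell_coeff (s : ℂ) (hs : s * s = 1 / 2) (hc : (starRingEnd ℂ) s = s) (i : Fin (2^2)) :
    coeffMat (bell s i) * (coeffMat (bell s i))ᴴ = (1 / 2 : ℂ) • 1 := by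
  change Fin 4 at i
  ext a b
  fin_cases i <;> fin_cases a <;> fin_cases b <;>
    simp [coeffMat, bell, Matrix.mul_apply, Fin.sum_univ_two, hc, hs]

lemma bell_inner (s : ℂ) (hs : s * s = 1 / 2) (hc : (starRingEnd ℂ) s = s) (i j : Fin (2^2)) :
    star (bell s i) ⬝ᵥ bell s j = if i = j then 1 else 0 := by
  change Fin 4 at i j
  fin_cases i <;> fin_cases j <;>
    simp [bell, dotProduct, Fintype.sum_prod_type, Fin.sum_univ_two, hc, hs] <;> norm_num

lemma bell_measurement (s : ℂ) (hs : s * s = 1 / 2) (hc : (starRingEnd ℂ) s = s) :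
    IsMeasurement (d := 2) (fun i => projVec (bell s i)) := by
  have hmul : ∀ i j, projVec (bell s i) * projVec (bell s j) =
      if i = j then projVec (bell s i) else 0 := by
    intro i j
    unfold projVec
    rw [Matrix.vecMulVec_mul_vecMulVec, bell_inner s hs hc]
    split_ifs with h
    · simp [h]
    · simp
  refine ⟨fun i => ⟨(Matrix.posSemidef_vecMulVec_self_star _).1, ?_, ?_⟩, ?_, ?_⟩
  · simpa using hmul i i
  · apply le_antisymm (Matrix.rank_vecMulVec_le _ _)
    rw [Nat.one_le_iff_ne_zero]
    intro h0
    rw [Matrix.rank, Submodule.finrank_eq_zero, LinearMap.range_eq_bot] at h0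
    replace h0 : projVec (bell s i) = 0 := by
      ext a b
      have := congrFun (LinearMap.congr_fun h0 (Pi.single b 1)) a
      simpa [projVec] using this
    have := congrArg Matrix.trace h0
    rw [projVec, Matrix.trace_vecMulVec, dotProduct_comm, bell_inner s hs hc] at this
    simp at this
  · intro i j hij
    simpa [hij] using hmul i j
  · change ∑ i : Fin 4, _ = _
    ext ⟨a, b⟩ ⟨c, d⟩
    rw [Fin.sum_univ_four]
    fin_cases a <;> fin_cases b <;> fin_cases c <;> fin_cases d <;>
      simp [projVec, bell, Matrix.vecMulVec_apply, hc, hs, Matrix.one_apply] <;> norm_num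

/-- For a state on C² ⊗ C² diagonal in a maximally entangled basis, M(ρ) = 1 − S(ρ);
in particular M(|ψ₊²⟩⟨ψ₊²|) = 1 for ψ₊² = (1/√2)(|00⟩ + |11⟩). -/
theorem stmt16 (ρ : Matrix (Fin 2 × Fin 2) (Fin 2 × Fin 2) ℂ) (hρ : IsState ρ)
    (P : Fin (2^2) → Matrix (Fin 2 × Fin 2) (Fin 2 × Fin 2) ℂ)
    (hP : IsMaxEntMeasurement P) (lam : Fin (2^2) → ℝ)
    (hl0 : ∀ i, 0 ≤ lam i) (hl1 : (∑ i, lam i) = 1)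
    (hdiag : ρ = ∑ i, (lam i : ℂ) • P i) :
    eep ρ = 1 - vnEntropy hρ.1.1 ∧
    eep (projVec (fun p : Fin 2 × Fin 2 =>
      if p.1 = p.2 then (((Real.sqrt 2)⁻¹ : ℝ) : ℂ) else 0)) = 1 := by
  have hm : ∀ i, ∃ ψ, coeffMat ψ * (coeffMat ψ)ᴴ = (1 / 2 : ℂ) • 1 ∧ P i = projVec ψ := by
    intro i
    obtain ⟨ψ, h, e⟩ := hP.2 i
    exact ⟨ψ, maxEnt_coeff h, e⟩
  constructor
  · rw [vnEntropy_eq hρ.1 hP.1.fam lam hl0 hdiag]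
    exact eep_eq hP.1 hm lam hl0 ρ hdiag
  · have hs : (((Real.sqrt 2)⁻¹ : ℝ) : ℂ) * (((Real.sqrt 2)⁻¹ : ℝ) : ℂ) = 1 / 2 := by
      rw [← Complex.ofReal_mul, ← mul_inv, Real.mul_self_sqrt (by norm_num)]
      norm_num
    have hc := Complex.conj_ofReal (Real.sqrt 2)⁻¹
    have hB := bell_measurement _ hs hc
    have e := eep_eq hB (fun i => ⟨_, bell_coeff _ hs hc i, rfl⟩) (fun i => if i = 0 then 1 else 0)
      (fun i => by split_ifs <;> norm_num) (projVec (bell (((Real.sqrt 2)⁻¹ : ℝ) : ℂ) 0))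
      (by simp)
    have hb : bell (((Real.sqrt 2)⁻¹ : ℝ) : ℂ) 0 = (fun p : Fin 2 × Fin 2 =>
        if p.1 = p.2 then (((Real.sqrt 2)⁻¹ : ℝ) : ℂ) else 0) := by
      funext ⟨a, b⟩
      fin_cases a <;> fin_cases b <;> simp [bell]
    rw [hb] at e
    rw [e]
    simp [shannon, apply_ite negMulLog2, negMulLog2_zero, negMulLog2_one]

end EEP
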